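/- Let A and B be associative, not necessarily unital ℂ-algebras, let E be a cofull right functional A-module, assume A has a left approximate unit and that the compact operator algebra K_A(E) has a left approximate unit, and let π : A → B be an algebra homomorphism. Then K_B(E ⊗_π B) has a left approximate unit. -/

import Mathlib

open scoped BigOperators TensorProduct

noncomputable section

/-- A right module structure for a (not necessarily unital) ℂ-algebra `A`
on a ℂ-vector space `E`. -/
structure RightMod (A : Type*) [NonUnitalRing A] [Module ℂ A]
    (E : Type*) [AddCommGroup E] [Module ℂ E] where
  sm : E → A → E
  add_sm : ∀ (x y : E) (a : A), sm (x + y) a = sm x a + sm y a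
  sm_add : ∀ (x : E) (a b : A), sm x (a + b) = sm x a + sm x b
  sm_mul : ∀ (x : E) (a b : A), sm (sm x a) b = sm x (a * b)
  csm_left : ∀ (c : ℂ) (x : E) (a : A), sm (c • x) a = c • sm x a
  csm_right : ∀ (c : ℂ) (x : E) (a : A), sm x (c • a) = c • sm x a

variable {A : Type*} [NonUnitalRing A] [Module ℂ A]

/-- `f : E → A` is a right `A`-module homomorphism into the standard module `A`. -/
def IsFunctional {E : Type*} [AddCommGroup E] [Module ℂ E]
    (r : RightMod A E) (f : E → A) : Prop :=
  (∀ x y : E, f (x + y) = f x + f y) ∧ (∀ (c : ℂ) (x : E), f (c • x) = c • f x) ∧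
    ∀ (x : E) (a : A), f (r.sm x a) = f x * a

/-- `Θ` is a functional space for the right `A`-module `(E, r)`:
a `G`-invariant left `A`-submodule of `Hom_A(E,A)`. -/
structure IsFunctionalSpace {E : Type*} [AddCommGroup E] [Module ℂ E]
    (r : RightMod A E) (Θ : Set (E → A)) : Prop where
  functional : ∀ φ ∈ Θ, IsFunctional r φ
  zero_mem : (0 : E → A) ∈ Θ
  add_mem : ∀ {φ ψ : E → A}, φ ∈ Θ → ψ ∈ Θ → φ + ψ ∈ Θ
  neg_mem : ∀ {φ : E → A}, φ ∈ Θ → -φ ∈ Θ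
  csmul_mem : ∀ (c : ℂ) {φ : E → A}, φ ∈ Θ → c • φ ∈ Θ
  lsmul_mem : ∀ (a : A) {φ : E → A}, φ ∈ Θ → (fun x => a * φ x) ∈ Θ

/-- Right `A`-module homomorphism between two right `A`-modules. -/
def IsModHom {E F : Type*} [AddCommGroup E] [Module ℂ E] [AddCommGroup F] [Module ℂ F]
    (rE : RightMod A E) (rF : RightMod A F) (U : E → F) : Prop :=
  (∀ x y : E, U (x + y) = U x + U y) ∧ (∀ (c : ℂ) (x : E), U (c • x) = c • U x) ∧
    ∀ (x : E) (a : A), U (rE.sm x a) = rF.sm (U x) a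

/-- A homomorphism of functional modules `(U, U^*)`. -/
structure IsFunctionalHom {E F : Type*} [AddCommGroup E] [Module ℂ E]
    [AddCommGroup F] [Module ℂ F]
    (rE : RightMod A E) (ΘE : Set (E → A)) (rF : RightMod A F) (ΘF : Set (F → A))
    (U : E → F) (Ustar : (E → A) → F → A) : Prop where
  hom : IsModHom rE rF U
  maps_mem : ∀ {φ : E → A}, φ ∈ ΘE → Ustar φ ∈ ΘF
  star_add : ∀ {φ ψ : E → A}, φ ∈ ΘE → ψ ∈ ΘE → Ustar (φ + ψ) = Ustar φ + Ustar ψ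
  star_csmul : ∀ (c : ℂ) {φ : E → A}, φ ∈ ΘE → Ustar (c • φ) = c • Ustar φ
  star_lsmul : ∀ (a : A) {φ : E → A}, φ ∈ ΘE →
      Ustar (fun x => a * φ x) = fun y => a * Ustar φ y
  compat : ∀ {φ : E → A}, φ ∈ ΘE → ∀ x : E, Ustar φ (U x) = φ x

/-- A functional extension. -/
structure IsFunctionalExtension {E F : Type*} [AddCommGroup E] [Module ℂ E]
    [AddCommGroup F] [Module ℂ F]
    (rE : RightMod A E) (ΘE : Set (E → A)) (rF : RightMod A F) (ΘF : Set (F → A))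
    (U : E → F) (Ustar : (E → A) → F → A)
    extends IsFunctionalHom rE ΘE rF ΘF U Ustar : Prop where
  inj : Function.Injective U
  lift : ∀ (k : ℕ) (φ : Fin k → E → A), (∀ i, φ i ∈ ΘE) → ∀ η : F,
      ∃ ξ : E, ∀ i, Ustar (φ i) η = φ i ξ

/-- The elementary compact operator `θ_{η,φ}`. -/
def elemOp {E : Type*} [AddCommGroup E] [Module ℂ E]
    (r : RightMod A E) (η : E) (φ : E → A) : E → E :=
  fun ξ => r.sm η (φ ξ)

/-- The set of compact operators on `(E, r, Θ)`: finite sums of elementary operators. -/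
def KSet {E : Type*} [AddCommGroup E] [Module ℂ E]
    (r : RightMod A E) (Θ : Set (E → A)) : Set (E → E) :=
  { T | ∃ (m : ℕ) (η : Fin m → E) (φ : Fin m → E → A),
      (∀ i, φ i ∈ Θ) ∧ T = ∑ i, elemOp r (η i) (φ i) }

end

section Std

variable (A : Type*) [NonUnitalRing A] [Module ℂ A] [SMulCommClass ℂ A A] [IsScalarTower ℂ A A]

/-- The standard right functional `A`-module structure on `A^n = n →₀ A`
(finitely supported families). -/
noncomputable def stdMod (n : Type*) : RightMod A (n →₀ A) where
  sm x a := Finsupp.mapRange (· * a) (zero_mul a) x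
  add_sm x y a := by ext i; simp [add_mul]
  sm_add x a b := by ext i; simp [mul_add]
  sm_mul x a b := by ext i; simp [mul_assoc]
  csm_left c x a := by ext i; simp [smul_mul_assoc]
  csm_right c x a := by ext i; simp [mul_smul_comm]

/-- The standard functional space on `A^n`: the vectors `x ∈ A^n` acting by
`x(ξ) = Σ_i x_i * ξ_i`. -/
def stdTheta (n : Type*) : Set ((n →₀ A) → A) :=
  { f | ∃ x : n →₀ A, ∀ ξ : n →₀ A, f ξ = x.sum fun i xi => xi * ξ i }

end Std

section Units

variable (A : Type*) [NonUnitalRing A]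

/-- `A` has a left approximate unit (discrete version: finitely many elements
admit a simultaneous left unit). -/
def HasLeftApproxUnit : Prop :=
  ∀ (m : ℕ) (a : Fin m → A), ∃ u : A, ∀ i, u * a i = a i

/-- `A` has a right approximate unit. -/
def HasRightApproxUnit : Prop :=
  ∀ (m : ℕ) (a : Fin m → A), ∃ u : A, ∀ i, a i * u = a i

/-- `A` has a two-sided approximate unit. -/
def HasTwoSidedApproxUnit : Prop :=
  ∀ (m : ℕ) (a : Fin m → A), ∃ u : A, ∀ i, u * a i = a i ∧ a i * u = a i

end Units

section KUnits

variable {A E : Type*} [NonUnitalRing A] [Module ℂ A] [AddCommGroup E] [Module ℂ E]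

/-- The algebra of compact operators of `(E, r, Θ)` has a left approximate unit
(multiplication being composition of operators). -/
def KSetHasLeftApproxUnit (r : RightMod A E) (Θ : Set (E → A)) : Prop :=
  ∀ (m : ℕ) (T : Fin m → E → E), (∀ i, T i ∈ KSet r Θ) →
    ∃ u ∈ KSet r Θ, ∀ i, u ∘ T i = T i

/-- The algebra of compact operators of `(E, r, Θ)` has a right approximate unit. -/
def KSetHasRightApproxUnit (r : RightMod A E) (Θ : Set (E → A)) : Prop :=
  ∀ (m : ℕ) (T : Fin m → E → E), (∀ i, T i ∈ KSet r Θ) →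
    ∃ u ∈ KSet r Θ, ∀ i, T i ∘ u = T i

/-- The algebra of compact operators of `(E, r, Θ)` has a two-sided approximate unit. -/
def KSetHasTwoSidedApproxUnit (r : RightMod A E) (Θ : Set (E → A)) : Prop :=
  ∀ (m : ℕ) (T : Fin m → E → E), (∀ i, T i ∈ KSet r Θ) →
    ∃ u ∈ KSet r Θ, ∀ i, u ∘ T i = T i ∧ T i ∘ u = T i

end KUnits

section Cofull

variable {A E : Type*} [NonUnitalRing A] [Module ℂ A] [AddCommGroup E] [Module ℂ E]

/-- The functional module `E` is cofull. -/
def CofullModule (r : RightMod A E) (Θ : Set (E → A)) : Prop :=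
  ∀ x : E, ∃ (m : ℕ) (ξ η : Fin m → E) (φ : Fin m → E → A),
    (∀ i, φ i ∈ Θ) ∧ x = ∑ i, r.sm (ξ i) (φ i (η i))

/-- The functional space `Θ` is cofull. -/
def CofullTheta (r : RightMod A E) (Θ : Set (E → A)) : Prop :=
  ∀ τ' ∈ Θ, ∃ (m : ℕ) (ξ : Fin m → E) (φ τ : Fin m → E → A),
    (∀ i, φ i ∈ Θ) ∧ (∀ i, τ i ∈ Θ) ∧ τ' = ∑ i, fun x => φ i (ξ i) * τ i x

end Cofull

section ITP

variable {A B E EB : Type*} [NonUnitalRing A] [Module ℂ A] [NonUnitalRing B] [Module ℂ B]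
  [AddCommGroup E] [Module ℂ E] [AddCommGroup EB] [Module ℂ EB]

/-- A (not necessarily unital) algebra homomorphism of ℂ-algebras. -/
def IsAlgHom (π : A → B) : Prop :=
  (∀ x y, π (x + y) = π x + π y) ∧ (∀ x y, π (x * y) = π x * π y) ∧
    ∀ (c : ℂ) (x : A), π (c • x) = c • π x

/-- The defining relations of the internal tensor product `E ⊗_π B`. -/
def itpRelations (π : A → B) (rE : RightMod A E) : Set (TensorProduct ℂ E B) :=
  { z | ∃ (ξ : E) (a : A) (b : B), z = (rE.sm ξ a) ⊗ₜ[ℂ] b - ξ ⊗ₜ[ℂ] (π a * b) }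

/-- `(EB, rEB, t)` realizes the internal tensor product `E ⊗_π B`:
`EB` is, via a ℂ-linear surjection with kernel the span of the defining relations,
the quotient `(E ⊗_ℂ B)/span{ξa ⊗ b − ξ ⊗ π(a)b}`, with `t ξ b` the class of `ξ ⊗ b`,
and the right `B`-action satisfies `(ξ ⊗ b)·b' = ξ ⊗ (bb')`. -/
structure IsInternalTensor (π : A → B) (rE : RightMod A E) (rEB : RightMod B EB)
    (t : E → B → EB) : Prop where
  exists_quot : ∃ q : TensorProduct ℂ E B →ₗ[ℂ] EB, Function.Surjective q ∧
      LinearMap.ker q = Submodule.span ℂ (itpRelations π rE) ∧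
      ∀ (ξ : E) (b : B), t ξ b = q (ξ ⊗ₜ[ℂ] b)
  sm_t : ∀ (ξ : E) (b b' : B), rEB.sm (t ξ b) b' = t ξ (b * b')

/-- The functional space of the internal tensor product `E ⊗_π B`:
the linear span of the functionals `φ ⊗ c` with `(φ ⊗ c)(ξ ⊗ b) = c·π(φ(ξ))·b`. -/
def internalTheta (π : A → B) (ΘE : Set (E → A)) (t : E → B → EB) : Set (EB → B) :=
  ↑(Submodule.span ℂ { h : EB → B | ∃ φ ∈ ΘE, ∃ c : B,
      (∀ x y, h (x + y) = h x + h y) ∧ ∀ (ξ : E) (b : B), h (t ξ b) = c * π (φ ξ) * b })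

end ITP

section RightModLemmas

variable {A E : Type*} [NonUnitalRing A] [Module ℂ A] [AddCommGroup E] [Module ℂ E]

lemma RightMod.sum_sm (r : RightMod A E) {ι : Type*} (s : Finset ι) (f : ι → E) (a : A) :
    r.sm (∑ i ∈ s, f i) a = ∑ i ∈ s, r.sm (f i) a :=
  map_sum (AddMonoidHom.mk' (fun x => r.sm x a) fun x y => r.add_sm x y a) f s

lemma elemOp_mem_KSet (r : RightMod A E) {Θ : Set (E → A)} (η : E) {φ : E → A} (hφ : φ ∈ Θ) :
    elemOp r η φ ∈ KSet r Θ :=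
  ⟨1, fun _ => η, fun _ => φ, fun _ => hφ, by simp⟩

/-- Compact operators are right module homomorphisms. -/
lemma isModHom_of_mem_KSet {r : RightMod A E} {Θ : Set (E → A)}
    (hΘ : ∀ φ ∈ Θ, IsFunctional r φ) {T : E → E} (hT : T ∈ KSet r Θ) : IsModHom r r T := by
  obtain ⟨m, η, φ, hφ, rfl⟩ := hT
  refine ⟨fun x y => ?_, fun c x => ?_, fun x a => ?_⟩
  · simp only [Finset.sum_apply, elemOp, (hΘ _ (hφ _)).1, r.sm_add, Finset.sum_add_distrib]
  · simp only [Finset.sum_apply, elemOp, (hΘ _ (hφ _)).2.1, r.csm_right, Finset.smul_sum]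
  · simp only [Finset.sum_apply, elemOp, (hΘ _ (hφ _)).2.2, r.sum_sm, r.sm_mul]

lemma IsModHom.map_sum {r : RightMod A E} {T : E → E} (hT : IsModHom r r T)
    {ι : Type*} (s : Finset ι) (f : ι → E) : T (∑ i ∈ s, f i) = ∑ i ∈ s, T (f i) :=
  _root_.map_sum (AddMonoidHom.mk' T hT.1) f s

/-- If finitely many vectors can always be fixed simultaneously by a compact operator, then the
compact operators have a left approximate unit. -/
lemma kSetHasLeftApproxUnit_of_exists_fixing {r : RightMod A E} {Θ : Set (E → A)}
    (hΘ : ∀ φ ∈ Θ, IsFunctional r φ)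
    (h : ∀ P : Set E, P.Finite → ∃ u ∈ KSet r Θ, ∀ x ∈ P, u x = x) :
    KSetHasLeftApproxUnit r Θ := by
  intro m T hT
  choose k η φ hφ hTeq using hT
  obtain ⟨u, hu, hfix⟩ := h (Set.range fun p : Σ i, Fin (k i) => η p.1 p.2) (Set.finite_range _)
  have hmod := isModHom_of_mem_KSet hΘ hu
  refine ⟨u, hu, fun i => funext fun x => ?_⟩
  simp only [Function.comp_apply, hTeq i, Finset.sum_apply, elemOp, hmod.map_sum, hmod.2.2]
  exact Finset.sum_congr rfl fun j _ => by rw [hfix _ ⟨⟨i, j⟩, rfl⟩]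

/-- On a cofull functional module, a left approximate unit of the compact operators fixes
finitely many vectors. -/
lemma KSetHasLeftApproxUnit.exists_fixing {r : RightMod A E} {Θ : Set (E → A)}
    (hΘ : ∀ φ ∈ Θ, IsFunctional r φ) (hK : KSetHasLeftApproxUnit r Θ)
    (hco : CofullModule r Θ) {P : Set E} (hP : P.Finite) :
    ∃ u ∈ KSet r Θ, ∀ x ∈ P, u x = x := by
  have := hP.to_subtype
  choose m ξ η φ hφ hx using hco
  obtain ⟨n, ⟨e⟩⟩ := Finite.exists_equiv_fin (Σ p : P, Fin (m p))
  let T : (Σ p : P, Fin (m p)) → E → E := fun p => elemOp r (ξ p.1 p.2) (φ p.1 p.2)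
  obtain ⟨u, hu, hfix⟩ := hK n (fun i => T (e.symm i)) fun i => elemOp_mem_KSet r _ (hφ _ _)
  refine ⟨u, hu, fun x hxP => ?_⟩
  conv_lhs => rw [hx x]
  conv_rhs => rw [hx x]
  rw [(isModHom_of_mem_KSet hΘ hu).map_sum]
  refine Finset.sum_congr rfl fun j _ => ?_
  have huT := hfix (e ⟨⟨x, hxP⟩, j⟩)
  rw [e.symm_apply_apply] at huT
  exact congr_fun huT (η x j)

end RightModLemmas

lemma HasLeftApproxUnit.exists_of_finite {A : Type*} [NonUnitalRing A]
    (hA : HasLeftApproxUnit A) {S : Set A} (hS : S.Finite) : ∃ u : A, ∀ a ∈ S, u * a = a := by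
  obtain ⟨n, f, -, rfl⟩ := hS.fin_param
  obtain ⟨u, hu⟩ := hA n f
  exact ⟨u, by rintro _ ⟨i, rfl⟩; exact hu i⟩

section InternalTensor

variable {A B E EB : Type*} [NonUnitalRing A] [Module ℂ A] [NonUnitalRing B] [Module ℂ B]
  [AddCommGroup E] [Module ℂ E] [AddCommGroup EB] [Module ℂ EB]
  {π : A → B} {rE : RightMod A E} {rEB : RightMod B EB} {t : E → B → EB}

lemma IsInternalTensor.exists_finite_mem_closure (ht : IsInternalTensor π rE rEB t) (y : EB) :
    ∃ P : Set E, P.Finite ∧ y ∈ AddSubmonoid.closure (Set.image2 t P Set.univ) := by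
  obtain ⟨q, hq, -, hqt⟩ := ht.exists_quot
  obtain ⟨z, rfl⟩ := hq y
  induction z with
  | zero => exact ⟨∅, Set.finite_empty, by simp⟩
  | tmul ξ b =>
    refine ⟨{ξ}, Set.finite_singleton ξ, ?_⟩
    rw [← hqt]
    exact AddSubmonoid.subset_closure (Set.mem_image2_of_mem rfl trivial)
  | add z w hz hw =>
    obtain ⟨P, hP, hzP⟩ := hz
    obtain ⟨Q, hQ, hwQ⟩ := hw
    refine ⟨P ∪ Q, hP.union hQ, ?_⟩
    rw [map_add]
    exact add_mem
      (AddSubmonoid.closure_mono (Set.image2_subset_right Set.subset_union_left) hzP)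
      (AddSubmonoid.closure_mono (Set.image2_subset_right Set.subset_union_right) hwQ)

lemma IsInternalTensor.induction_on (ht : IsInternalTensor π rE rEB t) {p : EB → Prop} (y : EB)
    (zero : p 0) (tmul : ∀ ξ b, p (t ξ b)) (add : ∀ x y, p x → p y → p (x + y)) : p y := by
  obtain ⟨P, -, hy⟩ := ht.exists_finite_mem_closure y
  induction hy using AddSubmonoid.closure_induction with
  | mem x hx => obtain ⟨ξ, -, b, -, rfl⟩ := hx; exact tmul ξ b
  | zero => exact zero
  | add x y _ _ hx hy => exact add x y hx hy

lemma IsInternalTensor.smul_t (ht : IsInternalTensor π rE rEB t) (c : ℂ) (ξ : E) (b : B) :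
    c • t ξ b = t (c • ξ) b := by
  obtain ⟨q, -, -, hqt⟩ := ht.exists_quot
  rw [hqt, hqt, ← map_smul, TensorProduct.smul_tmul']

lemma IsInternalTensor.sum_t (ht : IsInternalTensor π rE rEB t) {ι : Type*} (s : Finset ι)
    (ξ : ι → E) (b : B) : t (∑ i ∈ s, ξ i) b = ∑ i ∈ s, t (ξ i) b := by
  obtain ⟨q, -, -, hqt⟩ := ht.exists_quot
  simp only [hqt, TensorProduct.sum_tmul, map_sum]

lemma IsInternalTensor.t_sm (ht : IsInternalTensor π rE rEB t) (ξ : E) (a : A) (b : B) :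
    t (rE.sm ξ a) b = t ξ (π a * b) := by
  obtain ⟨q, -, hker, hqt⟩ := ht.exists_quot
  rw [hqt, hqt, ← sub_eq_zero, ← map_sub, ← LinearMap.mem_ker, hker]
  exact Submodule.subset_span ⟨ξ, a, b, rfl⟩

variable [SMulCommClass ℂ B B] [IsScalarTower ℂ B B] {ΘE : Set (E → A)}

/-- The functional `φ ⊗ c` on the internal tensor product. -/
lemma IsInternalTensor.exists_functional (ht : IsInternalTensor π rE rEB t) (hπ : IsAlgHom π)
    {φ : E → A} (hφ : IsFunctional rE φ) (c : B) :
    ∃ h : EB → B, (∀ x y, h (x + y) = h x + h y) ∧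
      ∀ (ξ : E) (b : B), h (t ξ b) = c * π (φ ξ) * b := by
  obtain ⟨q, hq, hker, hqt⟩ := ht.exists_quot
  let f : E →ₗ[ℂ] B →ₗ[ℂ] B := LinearMap.mk₂ ℂ (fun ξ b => c * π (φ ξ) * b)
    (fun x y b => by simp only [hφ.1, hπ.1, mul_add, add_mul])
    (fun z x b => by simp only [hφ.2.1, hπ.2.2, mul_smul_comm, smul_mul_assoc])
    (fun x b b' => mul_add _ _ _)
    (fun z x b => mul_smul_comm _ _ _)
  have hf : LinearMap.ker q ≤ LinearMap.ker (TensorProduct.lift f) := by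
    rw [hker, Submodule.span_le]
    rintro _ ⟨ξ, a, b, rfl⟩
    simp [f, hφ.2.2, hπ.2.1, mul_assoc]
  let g : EB →ₗ[ℂ] B := (LinearMap.ker q).liftQ (TensorProduct.lift f) hf ∘ₗ
    (q.quotKerEquivOfSurjective hq).symm.toLinearMap
  refine ⟨g, map_add g, fun ξ b => ?_⟩
  have hsymm : (q.quotKerEquivOfSurjective hq).symm (q (ξ ⊗ₜ[ℂ] b)) =
      (LinearMap.ker q).mkQ (ξ ⊗ₜ[ℂ] b) := by
    rw [LinearEquiv.symm_apply_eq]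
    rfl
  simp [g, hqt, hsymm, f]

lemma IsInternalTensor.isFunctional_of_mem (ht : IsInternalTensor π rE rEB t) (hπ : IsAlgHom π)
    (hΘ : ∀ φ ∈ ΘE, IsFunctional rE φ) {h : EB → B} (hh : h ∈ internalTheta π ΘE t) :
    IsFunctional rEB h := by
  induction hh using Submodule.span_induction with
  | mem h hh =>
    obtain ⟨φ, hφ, c, hadd, hval⟩ := hh
    have hzero : h 0 = 0 := map_zero (AddMonoidHom.mk' h hadd)
    refine ⟨hadd, fun z x => ?_, fun x b => ?_⟩
    · induction x using ht.induction_on with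
      | zero => simp [hzero]
      | tmul ξ b =>
        rw [ht.smul_t, hval, hval, (hΘ φ hφ).2.1, hπ.2.2, mul_smul_comm, smul_mul_assoc]
      | add x y hx hy => rw [smul_add, hadd, hx, hy, hadd, smul_add]
    · induction x using ht.induction_on with
      | zero =>
        have : rEB.sm 0 b = 0 := by simpa using rEB.csm_left 0 0 b
        rw [this, hzero, zero_mul]
      | tmul ξ b' => rw [ht.sm_t, hval, hval, mul_assoc _ b' b]
      | add x y hx hy => rw [rEB.add_sm, hadd, hx, hy, hadd, add_mul]
  | zero => exact ⟨by simp, by simp, by simp⟩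
  | add f g _ _ hf hg =>
    refine ⟨fun x y => ?_, fun z x => ?_, fun x b => ?_⟩
    · simp only [Pi.add_apply, hf.1, hg.1]; abel
    · simp only [Pi.add_apply, hf.2.1, hg.2.1, smul_add]
    · simp only [Pi.add_apply, hf.2.2, hg.2.2, add_mul]
  | smul w f _ hf =>
    refine ⟨fun x y => ?_, fun z x => ?_, fun x b => ?_⟩
    · simp only [Pi.smul_apply, hf.1, smul_add]
    · simp only [Pi.smul_apply, hf.2.1, smul_comm w z]
    · simp only [Pi.smul_apply, hf.2.2, smul_mul_assoc]

/-- A compact operator `u` on `E` induces on `E ⊗_π B` a compact operator agreeing with `u ⊗ 1`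
on the vectors `ξ ⊗ b` with `ξ` in a given finite set. -/
lemma IsInternalTensor.exists_mem_KSet (ht : IsInternalTensor π rE rEB t) (hπ : IsAlgHom π)
    (hΘ : ∀ φ ∈ ΘE, IsFunctional rE φ) (hA : HasLeftApproxUnit A) {u : E → E}
    (hu : u ∈ KSet rE ΘE) {P : Set E} (hP : P.Finite) :
    ∃ v ∈ KSet rEB (internalTheta π ΘE t), ∀ ξ ∈ P, ∀ b, v (t ξ b) = t (u ξ) b := by
  obtain ⟨m, η, φ, hφ, rfl⟩ := hu
  obtain ⟨a, ha⟩ := hA.exists_of_finite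
    (Set.Finite.image2 (fun i => φ i) (Set.finite_univ (α := Fin m)) hP)
  choose h hadd hval using fun i => ht.exists_functional hπ (hΘ _ (hφ i)) (π a)
  refine ⟨_, ⟨m, fun i => t (η i) (π a), h,
    fun i => Submodule.subset_span ⟨φ i, hφ i, π a, hadd i, hval i⟩, rfl⟩, fun ξ hξ b => ?_⟩
  simp only [Finset.sum_apply, elemOp, ht.sum_t]
  refine Finset.sum_congr rfl fun i _ => ?_
  have hai : π a * π (φ i ξ) = π (φ i ξ) := by
    rw [← hπ.2.1, ha _ (Set.mem_image2_of_mem trivial hξ)]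
  rw [ht.sm_t, ht.t_sm, hval, hai, ← mul_assoc, hai]

end InternalTensor

/-- If `E` is cofull, `A` has a left approximate unit and `K_A(E)` has a left approximate unit, then for any algebra homomorphism `π : A → B`, the algebra `K_B(E ⊗_π B)` has a left approximate unit. -/
theorem internalTensor_hasLeftApproxUnit
    {A B E EB : Type*} [NonUnitalRing A] [Module ℂ A]
    [SMulCommClass ℂ A A] [IsScalarTower ℂ A A]
    [NonUnitalRing B] [Module ℂ B] [SMulCommClass ℂ B B] [IsScalarTower ℂ B B]
    [AddCommGroup E] [Module ℂ E] [AddCommGroup EB] [Module ℂ EB]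
    (rE : RightMod A E) (ΘE : Set (E → A)) (hE : IsFunctionalSpace rE ΘE)
    (hco : CofullModule rE ΘE)
    (hA : HasLeftApproxUnit A)
    (hK : KSetHasLeftApproxUnit rE ΘE)
    (π : A → B) (hπ : IsAlgHom π)
    (rEB : RightMod B EB) (t : E → B → EB)
    (ht : IsInternalTensor π rE rEB t) :
    KSetHasLeftApproxUnit rEB (internalTheta π ΘE t) := by
  have hΘ := hE.functional
  refine kSetHasLeftApproxUnit_of_exists_fixing (fun h hh => ht.isFunctional_of_mem hπ hΘ hh)
    fun Y hY => ?_
  choose P hP hmem using ht.exists_finite_mem_closure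
  have hfin : (⋃ y ∈ Y, P y).Finite := hY.biUnion fun y _ => hP y
  obtain ⟨u, hu, hfix⟩ := hK.exists_fixing hΘ hco hfin
  obtain ⟨v, hv, hvt⟩ := ht.exists_mem_KSet hπ hΘ hA hu hfin
  have hmod := isModHom_of_mem_KSet (fun h hh => ht.isFunctional_of_mem hπ hΘ hh) hv
  refine ⟨v, hv, fun y hy => ?_⟩
  have hv_eq : Set.EqOn (AddMonoidHom.mk' v hmod.1) (AddMonoidHom.id EB)
      (Set.image2 t (P y) Set.univ) := by
    rintro _ ⟨ξ, hξ, b, -, rfl⟩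
    have hξ' := Set.mem_biUnion hy hξ
    simp [hvt ξ hξ', hfix ξ hξ']
  exact AddMonoidHom.eqOn_closureM hv_eq (hmem y)
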